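/- arXiv:1802.03504 — 2 statements merged into one kernel-verified Lean document; each statement's English description precedes it below -/
import Mathlib

section
/- Let h : ℝ^n → (−∞,∞] be proper lower semicontinuous convex and let g be differentiable on dom h with ∇g M-Lipschitz continuous on dom h, where M > 0. Let (ρ̄, ε̄) ∈ ℝ_{++}², and let (λ, z⁻, z, w, ε) ∈ ℝ_{++} × ℝ^n × ℝ^n × ℝ^n × ℝ_+ satisfy w ∈ ∂_ε( g + h + (1/(2λ))‖·−z⁻‖² )(z), ‖(1/λ)(z⁻−z) + w‖ ≤ ρ̄, and ε ≤ ε̄. Define z_g as a minimizer over ℝ^n of u ↦ ℓ_g(u; z) + h(u) + ((M+1/λ)/2)‖u−z‖², q_g := (M+1/λ)(z − z_g), and v_g := q_g + ∇g(z_g) − ∇g(z). Then v_g ∈ ∇g(z_g) + ∂h(z_g) and ‖v_g‖ ≤ 2‖q_g‖ ≤ 2[ρ̄ + √(2 ε̄ (M+1/λ))]. -/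
open RealInnerProductSpace

noncomputable section

/-- The ε-subdifferential of an extended-real-valued function `ψ` at `z`:
`∂_ε ψ(z) = {v : ∀ u, ψ(u) ≥ ψ(z) + ⟨v, u − z⟩ − ε}`. -/
def epsSubdiff {n : ℕ} (ψ : EuclideanSpace ℝ (Fin n) → EReal) (ε : EReal)
    (z : EuclideanSpace ℝ (Fin n)) : Set (EuclideanSpace ℝ (Fin n)) :=
  {v | ∀ u, ψ z + ((⟪v, u - z⟫ : ℝ) : EReal) - ε ≤ ψ u}

/-- The effective domain of an extended-real-valued function. -/
def edom {n : ℕ} (ψ : EuclideanSpace ℝ (Fin n) → EReal) : Set (EuclideanSpace ℝ (Fin n)) :=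
  {x | ψ x ≠ ⊤}

/-- `ψ` is proper: it never takes the value `−∞` and is not identically `+∞`. -/
def ProperFun {n : ℕ} (ψ : EuclideanSpace ℝ (Fin n) → EReal) : Prop :=
  (∀ x, ψ x ≠ ⊥) ∧ ∃ x, ψ x ≠ ⊤

/-- Convexity of an extended-real-valued function. -/
def ConvexEReal {n : ℕ} (ψ : EuclideanSpace ℝ (Fin n) → EReal) : Prop :=
  ∀ x y : EuclideanSpace ℝ (Fin n), ∀ α β : ℝ, 0 ≤ α → 0 ≤ β → α + β = 1 →
    ψ (α • x + β • y) ≤ (α : EReal) * ψ x + (β : EReal) * ψ y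

theorem coe_toReal_of_mem_edom {n : ℕ} {h : EuclideanSpace ℝ (Fin n) → EReal}
    (hproper : ProperFun h) {x : EuclideanSpace ℝ (Fin n)} (hx : x ∈ edom h) :
    (((h x).toReal : ℝ) : EReal) = h x :=
  EReal.coe_toReal hx (hproper.1 x)

theorem ConvexEReal.convexOn_toReal {n : ℕ} {h : EuclideanSpace ℝ (Fin n) → EReal}
    (hconv : ConvexEReal h) (hproper : ProperFun h) :
    ConvexOn ℝ (edom h) fun x => (h x).toReal := by
  have key : ∀ x ∈ edom h, ∀ y ∈ edom h, ∀ a b : ℝ, 0 ≤ a → 0 ≤ b → a + b = 1 →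
      h (a • x + b • y) ≤ ((a * (h x).toReal + b * (h y).toReal : ℝ) : EReal) := by
    intro x hx y hy a b ha hb hab
    have := hconv x y a b ha hb hab
    rw [← coe_toReal_of_mem_edom hproper hx, ← coe_toReal_of_mem_edom hproper hy] at this
    exact_mod_cast this
  have hmem : ∀ x ∈ edom h, ∀ y ∈ edom h, ∀ a b : ℝ, 0 ≤ a → 0 ≤ b → a + b = 1 →
      a • x + b • y ∈ edom h := fun x hx y hy a b ha hb hab =>
    ((key x hx y hy a b ha hb hab).trans_lt (EReal.coe_lt_top _)).ne
  refine ⟨fun x hx y hy a b ha hb hab => hmem x hx y hy a b ha hb hab, ?_⟩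
  intro x hx y hy a b ha hb hab
  have := key x hx y hy a b ha hb hab
  rw [← coe_toReal_of_mem_edom hproper (hmem x hx y hy a b ha hb hab)] at this
  exact_mod_cast this

section InnerProductSpace

variable {E : Type*} [NormedAddCommGroup E] [InnerProductSpace ℝ E]

/-- The descent lemma on a convex set. -/
theorem Convex.le_linearization_add_sq [CompleteSpace E] {s : Set E} (hs : Convex ℝ s)
    {g : E → ℝ} {G : E → E} {M : ℝ} (hg : ∀ x ∈ s, HasGradientAt g (G x) x)
    (hG : ∀ u ∈ s, ∀ x ∈ s, ‖G u - G x‖ ≤ M * ‖u - x‖) {x u : E} (hx : x ∈ s) (hu : u ∈ s) :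
    g u ≤ g x + ⟪G x, u - x⟫ + M / 2 * ‖u - x‖ ^ 2 := by
  have hmem : ∀ t ∈ Set.Icc (0 : ℝ) 1, x + t • (u - x) ∈ s := fun t ht =>
    hs.add_smul_sub_mem hx hu ht
  have hder : ∀ t ∈ Set.Icc (0 : ℝ) 1,
      HasDerivAt (fun t : ℝ => g (x + t • (u - x)) - t * ⟪G x, u - x⟫ - M / 2 * t ^ 2 * ‖u - x‖ ^ 2)
        (⟪G (x + t • (u - x)) - G x, u - x⟫ - M * t * ‖u - x‖ ^ 2) t := by
    intro t ht
    have hline : HasDerivAt (fun t : ℝ => x + t • (u - x)) (u - x) t := by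
      simpa using ((hasDerivAt_id t).smul_const (u - x)).const_add x
    have hcomp := (hg _ (hmem t ht)).hasFDerivAt.comp_hasDerivAt t hline
    have hlin := (hasDerivAt_id t).mul_const ⟪G x, u - x⟫
    have hsq := (((hasDerivAt_id t).pow 2).const_mul (M / 2)).mul_const (‖u - x‖ ^ 2)
    refine ((hcomp.sub hlin).sub hsq).congr_deriv ?_
    simp only [inner_sub_left, InnerProductSpace.toDual_apply_apply, id, Nat.cast_ofNat]
    ring
  have hanti : AntitoneOn
      (fun t : ℝ => g (x + t • (u - x)) - t * ⟪G x, u - x⟫ - M / 2 * t ^ 2 * ‖u - x‖ ^ 2)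
      (Set.Icc 0 1) := by
    refine antitoneOn_of_hasDerivWithinAt_nonpos (convex_Icc 0 1)
      (fun t ht => (hder t ht).continuousAt.continuousWithinAt)
      (fun t ht => (hder t (interior_subset ht)).hasDerivWithinAt) fun t ht => ?_
    have ht' := interior_subset ht
    have hnorm : ‖G (x + t • (u - x)) - G x‖ ≤ M * (t * ‖u - x‖) := by
      simpa [norm_smul, abs_of_nonneg ht'.1] using hG _ (hmem t ht') x hx
    have hinner := real_inner_le_norm (G (x + t • (u - x)) - G x) (u - x)
    have hmul := mul_le_mul_of_nonneg_right hnorm (norm_nonneg (u - x))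
    linarith
  have := hanti (Set.left_mem_Icc.2 zero_le_one) (Set.right_mem_Icc.2 zero_le_one) zero_le_one
  simp at this
  linarith

theorem nonneg_of_forall_nonneg_add_mul {a b : ℝ} (H : ∀ t : ℝ, 0 < t → t ≤ 1 → 0 ≤ a + t * b) :
    0 ≤ a := by
  have hlim : Filter.Tendsto (fun t : ℝ => a + t * b) (nhdsWithin 0 (Set.Ioi 0)) (nhds a) := by
    have hcont : Continuous fun t : ℝ => a + t * b := by fun_prop
    simpa using (hcont.tendsto 0).mono_left nhdsWithin_le_nhds
  refine ge_of_tendsto hlim ?_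
  filter_upwards [Ioc_mem_nhdsGT (zero_lt_one' ℝ)] with t ht using H t ht.1 ht.2

/-- First-order optimality condition for the proximal point of a convex function. -/
theorem ConvexOn.subgradient_of_prox {s : Set E} {f : E → ℝ} (hf : ConvexOn ℝ s f)
    {a z y : E} {L : ℝ} (hy : y ∈ s)
    (hmin : ∀ u ∈ s, ⟪a, y - z⟫ + L / 2 * ‖y - z‖ ^ 2 + f y ≤
      ⟪a, u - z⟫ + L / 2 * ‖u - z‖ ^ 2 + f u) {u : E} (hu : u ∈ s) :
    f y + ⟪L • (z - y) - a, u - y⟫ ≤ f u := by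
  have key : ∀ t : ℝ, 0 < t → t ≤ 1 →
      0 ≤ (f u - f y - ⟪L • (z - y) - a, u - y⟫) + t * (L / 2 * ‖u - y‖ ^ 2) := by
    intro t ht0 ht1
    have hmem := hf.1 hy hu (sub_nonneg.2 ht1) ht0.le (sub_add_cancel 1 t)
    have hcv := hf.2 hy hu (sub_nonneg.2 ht1) ht0.le (sub_add_cancel 1 t)
    have hm := hmin _ hmem
    have hpt : (1 - t) • y + t • u - z = (y - z) + t • (u - y) := by module
    have hneg : z - y = -(y - z) := (neg_sub y z).symm
    rw [hpt, norm_add_sq_real, inner_add_right, norm_smul, Real.norm_eq_abs, mul_pow, sq_abs,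
      inner_smul_right, inner_smul_right] at hm
    rw [inner_sub_left, real_inner_smul_left, hneg, inner_neg_left]
    simp only [smul_eq_mul] at hcv
    refine (mul_nonneg_iff_of_pos_left ht0).1 ?_
    nlinarith
  have := nonneg_of_forall_nonneg_add_mul key
  linarith

end InnerProductSpace

theorem le_add_sqrt_of_forall_segment {q ρ c : ℝ} (hρ : 0 ≤ ρ)
    (H : ∀ t : ℝ, 0 ≤ t → t ≤ 1 → t * q ^ 2 - t ^ 2 / 2 * q ^ 2 ≤ c + t * (ρ * q)) :
    q ≤ ρ + Real.sqrt (2 * c) := by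
  rcases le_or_gt q ρ with hq | hq
  · linarith [Real.sqrt_nonneg (2 * c)]
  have hq0 : 0 < q := hρ.trans_lt hq
  have hopt := H ((q - ρ) / q) (by bound) ((div_le_one hq0).2 (by linarith))
  field_simp at hopt
  have : q - ρ ≤ Real.sqrt (2 * c) := Real.le_sqrt_of_sq_le (by nlinarith)
  linarith

/-- Proposition 2.1(c) of the paper. If moreover `∇g` is `M`-Lipschitz
on `dom h`, then `v_g = q_g + ∇g(z_g) − ∇g(z)` satisfies `v_g ∈ ∇g(z_g) + ∂h(z_g)` and
`‖v_g‖ ≤ 2‖q_g‖ ≤ 2(ρ̄ + √(2ε̄(M + 1/λ)))`. -/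
theorem prox_refinement_c {n : ℕ} (h : EuclideanSpace ℝ (Fin n) → EReal)
    (hproper : ProperFun h) (hlsc : LowerSemicontinuous h) (hconv : ConvexEReal h)
    (g : EuclideanSpace ℝ (Fin n) → ℝ) (Gg : EuclideanSpace ℝ (Fin n) → EuclideanSpace ℝ (Fin n))
    (M : ℝ) (hM : 0 < M)
    (hdiff : ∀ x ∈ edom h, HasGradientAt g (Gg x) x)
    (hlip : ∀ u ∈ edom h, ∀ zt ∈ edom h, ‖Gg u - Gg zt‖ ≤ M * ‖u - zt‖)
    (ρbar εbar : ℝ) (hρbar : 0 < ρbar) (hεbar : 0 < εbar)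
    (lam : ℝ) (hlam : 0 < lam)
    (zm z w : EuclideanSpace ℝ (Fin n)) (ε : ℝ) (hε0 : 0 ≤ ε)
    (hw : w ∈ epsSubdiff
      (fun u => ((g u + 1 / (2 * lam) * ‖u - zm‖ ^ 2 : ℝ) : EReal) + h u) ((ε : ℝ) : EReal) z)
    (hρ : ‖(1 / lam) • (zm - z) + w‖ ≤ ρbar) (hεε : ε ≤ εbar)
    (zg : EuclideanSpace ℝ (Fin n))
    (hzg : ∀ u : EuclideanSpace ℝ (Fin n),
      ((g z + ⟪Gg z, zg - z⟫ + (M + 1 / lam) / 2 * ‖zg - z‖ ^ 2 : ℝ) : EReal) + h zg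
        ≤ ((g z + ⟪Gg z, u - z⟫ + (M + 1 / lam) / 2 * ‖u - z‖ ^ 2 : ℝ) : EReal) + h u)
    (qg : EuclideanSpace ℝ (Fin n)) (hqg : qg = (M + 1 / lam) • (z - zg))
    (vg : EuclideanSpace ℝ (Fin n)) (hvg : vg = qg + Gg zg - Gg z) :
    vg - Gg zg ∈ epsSubdiff h (0 : EReal) zg ∧
    ‖vg‖ ≤ 2 * ‖qg‖ ∧
    2 * ‖qg‖ ≤ 2 * (ρbar + Real.sqrt (2 * εbar * (M + 1 / lam))) := by
  have hcvx := hconv.convexOn_toReal hproper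
  obtain ⟨x₀, hx₀⟩ := hproper.2
  have hz : z ∈ edom h := by
    intro hz
    have hle := hw x₀
    beta_reduce at hle
    rw [← coe_toReal_of_mem_edom hproper hx₀] at hle
    simp only [hz, EReal.coe_add_top, EReal.top_add_coe, EReal.top_sub_coe, top_le_iff] at hle
    exact EReal.coe_ne_top _ (by exact_mod_cast hle)
  have hzg_mem : zg ∈ edom h := by
    intro htop
    have hle := hzg x₀
    rw [← coe_toReal_of_mem_edom hproper hx₀, htop, EReal.coe_add_top, top_le_iff] at hle
    exact EReal.coe_ne_top _ (by exact_mod_cast hle)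
  set L := M + 1 / lam with hL
  have hL0 : 0 < L := by positivity
  have hsub : ∀ u ∈ edom h,
      (h zg).toReal + ⟪L • (z - zg) - Gg z, u - zg⟫ ≤ (h u).toReal := by
    intro u hu
    refine hcvx.subgradient_of_prox hzg_mem (fun v hv => ?_) hu
    have hle := hzg v
    rw [← coe_toReal_of_mem_edom hproper hv, ← coe_toReal_of_mem_edom hproper hzg_mem] at hle
    have hle' := EReal.coe_le_coe_iff.1 (by exact_mod_cast hle)
    linarith
  have hq : ‖qg‖ = L * ‖zg - z‖ := by
    rw [hqg, norm_smul, Real.norm_of_nonneg hL0.le, norm_sub_rev]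
  refine ⟨?_, ?_, ?_⟩
  · intro u
    by_cases hu : u ∈ edom h
    · rw [← coe_toReal_of_mem_edom hproper hu, ← coe_toReal_of_mem_edom hproper hzg_mem,
        sub_zero]
      have hv : vg - Gg zg = L • (z - zg) - Gg z := by rw [hvg, hqg]; abel
      rw [hv]
      exact_mod_cast hsub u hu
    · have htop : h u = ⊤ := not_not.1 hu
      rw [htop]
      exact le_top
  · have hML : M * ‖zg - z‖ ≤ L * ‖zg - z‖ := by
      gcongr
      simp [hL, hlam.le]
    have htri := norm_add_le qg (Gg zg - Gg z)
    rw [hvg, add_sub_assoc]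
    linarith [hlip zg hzg_mem z hz]
  · suffices hbound : ‖qg‖ ≤ ρbar + Real.sqrt (2 * (εbar * L)) by
      rw [mul_assoc]
      linarith
    refine le_add_sqrt_of_forall_segment hρbar.le fun t ht0 ht1 => ?_
    have hmem := hcvx.1 hz hzg_mem (sub_nonneg.2 ht1) ht0 (sub_add_cancel 1 t)
    have hcv := hcvx.2 hz hzg_mem (sub_nonneg.2 ht1) ht0 (sub_add_cancel 1 t)
    have hdesc := hcvx.1.le_linearization_add_sq hdiff hlip hz hmem
    have hle := hw ((1 - t) • z + t • zg)
    beta_reduce at hle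
    rw [← coe_toReal_of_mem_edom hproper hmem, ← coe_toReal_of_mem_edom hproper hz] at hle
    have hle' := EReal.coe_le_coe_iff.1 (by exact_mod_cast hle)
    have hopt := hsub z hz
    have hpt : (1 - t) • z + t • zg - z = t • (zg - z) := by module
    have hpt' : (1 - t) • z + t • zg - zm = t • (zg - z) + (z - zm) := by module
    have hcs := abs_le.1 (abs_real_inner_le_norm ((1 / lam) • (zm - z) + w) (zg - z))
    have hneg : z - zg = -(zg - z) := (neg_sub zg z).symm
    have hneg' : zm - z = -(z - zm) := (neg_sub z zm).symm
    rw [hpt, norm_smul, Real.norm_eq_abs, mul_pow, sq_abs, inner_smul_right] at hdesc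
    rw [hpt, hpt', norm_add_sq_real, norm_smul, Real.norm_eq_abs, mul_pow, sq_abs,
      inner_smul_right, real_inner_smul_left] at hle'
    rw [hneg, inner_neg_right, inner_sub_left, real_inner_smul_left, inner_neg_left,
      real_inner_self_eq_norm_sq] at hopt
    rw [hneg', inner_add_left, real_inner_smul_left, inner_neg_left, ← hneg',
      real_inner_comm (zg - z) (z - zm)] at hcs
    have hk : 1 / (2 * lam) = 1 / lam / 2 := by field_simp
    rw [hk] at hle'
    have hMk : M = L - 1 / lam := by rw [hL]; ring
    rw [hMk] at hdesc
    simp only [smul_eq_mul] at hcv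
    have hr := mul_le_mul_of_nonneg_right hρ (norm_nonneg (zg - z))
    generalize 1 / lam = k at *
    have hmain : t * (L * ‖zg - z‖ ^ 2) - t ^ 2 / 2 * (L * ‖zg - z‖ ^ 2) ≤
        εbar + t * (ρbar * ‖zg - z‖) := by
      linear_combination hle' + hdesc + hcv + t * hopt + t * hcs.1 + t * hr + hεε
    rw [hq]
    linear_combination L * hmain
end
end

section
/- Let h : ℝ^n → (−∞,∞] be proper lower semicontinuous convex, let z ∈ dom h, and let f be differentiable on dom h with f(u) − ℓ_f(u;z) ≤ (L/2)‖u−z‖² for all u ∈ dom h, where L > 0. Let z_f be a minimizer over ℝ^n of u ↦ ℓ_f(u; z) + h(u) + (L/2)‖u−z‖², and define q_f := L(z − z_f) and δ_f := h(z) − h(z_f) − ⟨q_f − ∇f(z), z − z_f⟩. Then: (i) q_f ∈ ∇f(z) + ∂h(z_f); (ii) δ_f ≥ 0 and q_f ∈ ∇f(z) + ∂_{δ_f} h(z); (iii) δ_f + (1/(2L))‖q_f‖² ≤ (f+h)(z) − (f+h)(z_f). -/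
open RealInnerProductSpace

noncomputable section

/-- If `t * a + t ^ 2 * b` is nonnegative for all `t ∈ (0, 1]`, then `a` is nonnegative. -/
theorem nonneg_of_forall_mul_add_sq_mul_nonneg {a b : ℝ}
    (hab : ∀ t : ℝ, 0 < t → t ≤ 1 → 0 ≤ t * a + t ^ 2 * b) : 0 ≤ a := by
  by_contra! ha
  have hpos : 0 < |b| + |a| := add_pos_of_nonneg_of_pos (abs_nonneg b) (abs_pos.mpr ha.ne)
  set t : ℝ := -a / (2 * (|b| + |a|)) with ht
  have ht0 : 0 < t := div_pos (neg_pos.mpr ha) (by positivity)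
  have htm : t * (2 * (|b| + |a|)) = -a := div_mul_cancel₀ _ (by positivity)
  have ht1 : t ≤ 1 := by
    rw [ht, div_le_one (by positivity)]
    linarith [abs_nonneg b, abs_nonneg a, neg_le_abs a]
  have h1 : 0 ≤ t * (a + t * b) := by linarith [hab t ht0 ht1]
  have h2 := nonneg_of_mul_nonneg_right h1 ht0
  linarith [mul_le_mul_of_nonneg_left (le_abs_self b) ht0.le, mul_nonneg ht0.le (abs_nonneg a)]

/-- First-order optimality for a linear term plus a convex function plus a quadratic:
if `w` minimizes `u ↦ c + ⟪g, u - z⟫ + L / 2 * ‖u - z‖ ^ 2 + ψ u` and `ψ w` is finite, then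
`L • (z - w) - g` is a subgradient of `ψ` at `w`. -/
theorem ConvexEReal.sub_mem_epsSubdiff_zero_of_isMin {n : ℕ}
    {ψ : EuclideanSpace ℝ (Fin n) → EReal} (hconv : ConvexEReal ψ) (hbot : ∀ x, ψ x ≠ ⊥)
    {z w g : EuclideanSpace ℝ (Fin n)} {c L : ℝ} (hw : ψ w ≠ ⊤)
    (hmin : ∀ u : EuclideanSpace ℝ (Fin n),
      ((c + ⟪g, w - z⟫ + L / 2 * ‖w - z‖ ^ 2 : ℝ) : EReal) + ψ w
        ≤ ((c + ⟪g, u - z⟫ + L / 2 * ‖u - z‖ ^ 2 : ℝ) : EReal) + ψ u) :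
    L • (z - w) - g ∈ epsSubdiff ψ 0 w := by
  intro u
  by_cases hu : ψ u = ⊤
  · simp [hu]
  lift ψ w to ℝ using ⟨hw, hbot w⟩ with a ha
  lift ψ u to ℝ using ⟨hu, hbot u⟩ with b hb
  rw [sub_zero]
  norm_cast
  have key : 0 ≤ b - a - ⟪L • (z - w) - g, u - w⟫ := by
    refine nonneg_of_forall_mul_add_sq_mul_nonneg (b := L / 2 * ‖u - w‖ ^ 2) fun t ht0 ht1 => ?_
    have h1 := (hmin ((1 - t) • w + t • u)).trans (add_le_add_right
      (hconv w u (1 - t) t (sub_nonneg.mpr ht1) ht0.le (sub_add_cancel 1 t)) _)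
    rw [← ha, ← hb] at h1
    norm_cast at h1
    have hx : (1 - t) • w + t • u - z = (w - z) + t • (u - w) := by module
    have hzw : z - w = -(w - z) := (neg_sub w z).symm
    rw [hx, norm_add_sq_real, norm_smul, mul_pow, Real.norm_eq_abs, sq_abs, inner_add_right,
      inner_smul_right, inner_smul_right] at h1
    rw [inner_sub_left, real_inner_smul_left, hzw, inner_neg_left]
    linarith
  linarith

/-- Lemma A.1, parts \eqref{inclusion_qf} and \eqref{ineq:qfdeltaf}, of
the paper. Properties of the composite gradient step `z_f` from `z`:
`q_f ∈ ∇f(z) + ∂h(z_f)`, `δ_f ≥ 0`, `q_f ∈ ∇f(z) + ∂_{δ_f}h(z)`, and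
`δ_f + ‖q_f‖²/(2L) ≤ (f+h)(z) − (f+h)(z_f)`. -/
theorem composite_step_properties {n : ℕ} (h : EuclideanSpace ℝ (Fin n) → EReal)
    (hproper : ProperFun h) (hlsc : LowerSemicontinuous h) (hconv : ConvexEReal h)
    (z : EuclideanSpace ℝ (Fin n)) (hz : z ∈ edom h)
    (f : EuclideanSpace ℝ (Fin n) → ℝ)
    (Gf : EuclideanSpace ℝ (Fin n) → EuclideanSpace ℝ (Fin n))
    (hdiff : ∀ x ∈ edom h, HasGradientAt f (Gf x) x)
    (L : ℝ) (hL : 0 < L)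
    (hcurv : ∀ u ∈ edom h, f u - (f z + ⟪Gf z, u - z⟫) ≤ L / 2 * ‖u - z‖ ^ 2)
    (zf : EuclideanSpace ℝ (Fin n))
    (hzf : ∀ u : EuclideanSpace ℝ (Fin n),
      ((f z + ⟪Gf z, zf - z⟫ + L / 2 * ‖zf - z‖ ^ 2 : ℝ) : EReal) + h zf
        ≤ ((f z + ⟪Gf z, u - z⟫ + L / 2 * ‖u - z‖ ^ 2 : ℝ) : EReal) + h u)
    (qf : EuclideanSpace ℝ (Fin n)) (hqf : qf = L • (z - zf))
    (δf : EReal) (hδf : δf = h z - h zf - ((⟪qf - Gf z, z - zf⟫ : ℝ) : EReal)) :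
    qf - Gf z ∈ epsSubdiff h (0 : EReal) zf ∧
    (0 ≤ δf ∧ qf - Gf z ∈ epsSubdiff h δf z) ∧
    δf + ((1 / (2 * L) * ‖qf‖ ^ 2 : ℝ) : EReal)
      ≤ (((f z : ℝ) : EReal) + h z) - (((f zf : ℝ) : EReal) + h zf) := by
  have hbot := hproper.1
  have hzf_top : h zf ≠ ⊤ := by
    intro htop
    have h1 := hzf z
    rw [htop, EReal.coe_add_top, top_le_iff] at h1
    exact EReal.add_ne_top (EReal.coe_ne_top _) hz h1
  have hsub : qf - Gf z ∈ epsSubdiff h 0 zf :=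
    hqf ▸ hconv.sub_mem_epsSubdiff_zero_of_isMin hbot hzf_top hzf
  obtain ⟨a, ha⟩ : ∃ a : ℝ, (a : EReal) = h z := ⟨_, EReal.coe_toReal hz (hbot z)⟩
  obtain ⟨b, hb⟩ : ∃ b : ℝ, (b : EReal) = h zf := ⟨_, EReal.coe_toReal hzf_top (hbot zf)⟩
  refine ⟨hsub, ⟨?_, fun u => ?_⟩, ?_⟩
  · have h1 := hsub z
    rw [sub_zero, ← ha, ← hb] at h1
    rw [hδf, ← ha, ← hb]
    norm_cast at h1 ⊢
    linarith
  · refine le_trans (le_of_eq ?_) (hsub u)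
    rw [hδf, sub_zero, ← ha, ← hb]
    norm_cast
    rw [← sub_add_sub_cancel u z zf, inner_add_right]
    ring
  · have hc := hcurv zf hzf_top
    rw [hδf, ← ha, ← hb]
    norm_cast
    have hnorm : 1 / (2 * L) * ‖qf‖ ^ 2 = L / 2 * ‖z - zf‖ ^ 2 := by
      rw [hqf, norm_smul, mul_pow, Real.norm_eq_abs, sq_abs]
      field_simp
    rw [norm_sub_rev, ← neg_sub z zf, inner_neg_right] at hc
    rw [hnorm, inner_sub_left, hqf, real_inner_smul_left, real_inner_self_eq_norm_sq]
    linarith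
end
end
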